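/- arXiv:1409.0370 — 3 statements merged into one kernel-verified Lean document; each statement's English description precedes it below -/
import Mathlib

section
/- Let γ = (a b; c d) ∈ SL₂(ℝ) with c ≠ 0, and let τ, z ∈ ℍ. Then arg(γτ − γ(z̄)) = arg(τ − z̄) − arg(cτ + d) − arg(c·z̄ + d), where z̄ is the complex conjugate of z and γw = (aw + b)/(cw + d) denotes the Möbius action (note γτ ∈ ℍ and γ(z̄) lies in the lower half-plane, so all quantities whose arguments are taken are nonzero). -/
open Complex

noncomputable section

/-- The automorphy factor `j(γ, z) = c z + d` for `γ = (a b; c d) ∈ SL₂(ℝ)`. -/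
def jfac (γ : Matrix.SpecialLinearGroup (Fin 2) ℝ) (z : ℂ) : ℂ :=
  (γ.1 1 0 : ℝ) * z + (γ.1 1 1 : ℝ)

/-- The Möbius action `γ z = (a z + b)/(c z + d)`. -/
def moeb (γ : Matrix.SpecialLinearGroup (Fin 2) ℝ) (z : ℂ) : ℂ :=
  ((γ.1 0 0 : ℝ) * z + (γ.1 0 1 : ℝ)) / jfac γ z

lemma Complex.arg_mem_Ioo_of_im_pos {w : ℂ} (hw : 0 < w.im) : w.arg ∈ Set.Ioo 0 Real.pi := by
  refine ⟨(arg_nonneg_iff.2 hw.le).lt_of_ne fun h => ?_, arg_lt_pi_iff.2 (Or.inr hw.ne')⟩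
  exact hw.ne (arg_eq_zero_iff.1 h.symm).2.symm

lemma Complex.arg_mem_Ioo_of_im_neg {w : ℂ} (hw : w.im < 0) : w.arg ∈ Set.Ioo (-Real.pi) 0 :=
  ⟨neg_pi_lt_arg w, arg_neg_iff.2 hw⟩

lemma jfac_im (γ : Matrix.SpecialLinearGroup (Fin 2) ℝ) (w : ℂ) :
    (jfac γ w).im = γ.1 1 0 * w.im := by
  simp [jfac]

lemma jfac_ne_zero {γ : Matrix.SpecialLinearGroup (Fin 2) ℝ} (hc : γ.1 1 0 ≠ 0) {w : ℂ}
    (hw : w.im ≠ 0) : jfac γ w ≠ 0 := fun h =>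
  mul_ne_zero hc hw <| by rw [← jfac_im, h, zero_im]

lemma moeb_im (γ : Matrix.SpecialLinearGroup (Fin 2) ℝ) (w : ℂ) :
    (moeb γ w).im = w.im / normSq (jfac γ w) := by
  have hdet := Matrix.det_fin_two γ.1
  rw [γ.2] at hdet
  rw [moeb, div_im, ← sub_div]
  congr 1
  simp only [jfac, add_re, add_im, re_ofReal_mul, im_ofReal_mul, ofReal_re, ofReal_im, add_zero]
  linear_combination -w.im * hdet

lemma moeb_sub_moeb (γ : Matrix.SpecialLinearGroup (Fin 2) ℝ) {w v : ℂ}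
    (hw : jfac γ w ≠ 0) (hv : jfac γ v ≠ 0) :
    moeb γ w - moeb γ v = (w - v) / jfac γ w / jfac γ v := by
  have hdet : (1 : ℂ) = γ.1 0 0 * γ.1 1 1 - γ.1 0 1 * γ.1 1 0 := by
    have h := Matrix.det_fin_two γ.1
    rw [γ.2] at h
    exact_mod_cast h
  rw [moeb, moeb, div_sub_div _ _ hw hv, div_div]
  congr 1
  simp only [jfac]
  linear_combination -(w - v) * hdet

/-- For `γ = (a b; c d) ∈ SL₂(ℝ)` with `c ≠ 0` and `τ, z ∈ ℍ`, one has
`arg (γτ - γz̄) = arg (τ - z̄) - arg (cτ + d) - arg (cz̄ + d)`,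
where `arg` is the principal argument with values in `(-π, π]`. -/
theorem arg_moebius_identity (γ : Matrix.SpecialLinearGroup (Fin 2) ℝ)
    (hc : γ.1 1 0 ≠ 0) (τ z : ℂ) (hτ : 0 < τ.im) (hz : 0 < z.im) :
    Complex.arg (moeb γ τ - moeb γ ((starRingEnd ℂ) z)) =
      Complex.arg (τ - (starRingEnd ℂ) z) - Complex.arg (jfac γ τ)
        - Complex.arg (jfac γ ((starRingEnd ℂ) z)) := by
  have hz' : ((starRingEnd ℂ) z).im < 0 := by simpa using hz
  have hjτ := jfac_ne_zero hc hτ.ne'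
  have hjz := jfac_ne_zero hc hz'.ne
  have hsub : 0 < (τ - (starRingEnd ℂ) z).im := by
    rw [sub_im]
    linarith
  have him : 0 < (moeb γ τ - moeb γ ((starRingEnd ℂ) z)).im := by
    rw [sub_im, moeb_im, moeb_im]
    have h₁ := div_pos hτ (normSq_pos.2 hjτ)
    have h₂ := div_neg_of_neg_of_pos hz' (normSq_pos.2 hjz)
    linarith
  have hne : τ - (starRingEnd ℂ) z ≠ 0 := fun h => by simp [h] at hsub
  have hang : (arg (moeb γ τ - moeb γ ((starRingEnd ℂ) z)) : Real.Angle) =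
      ((arg (τ - (starRingEnd ℂ) z) - arg (jfac γ τ)
        - arg (jfac γ ((starRingEnd ℂ) z)) : ℝ) : Real.Angle) := by
    rw [moeb_sub_moeb γ hjτ hjz, arg_div_coe_angle (div_ne_zero hne hjτ) hjz,
      arg_div_coe_angle hne hjτ, Real.Angle.coe_sub, Real.Angle.coe_sub]
  obtain ⟨k, hk⟩ := Real.Angle.angle_eq_iff_two_pi_dvd_sub.1 hang
  obtain ⟨hl₁, hl₂⟩ := arg_mem_Ioo_of_im_pos him
  obtain ⟨hs₁, hs₂⟩ := arg_mem_Ioo_of_im_pos hsub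
  have hj : |arg (jfac γ τ) + arg (jfac γ ((starRingEnd ℂ) z))| < Real.pi := by
    rw [abs_lt]
    rcases hc.lt_or_gt with h | h
    · obtain ⟨h₁, h₂⟩ := arg_mem_Ioo_of_im_neg
        ((jfac_im γ τ).trans_lt (mul_neg_of_neg_of_pos h hτ))
      obtain ⟨h₃, h₄⟩ := arg_mem_Ioo_of_im_pos
        ((mul_pos_of_neg_of_neg h hz').trans_eq (jfac_im γ _).symm)
      constructor <;> linarith
    · obtain ⟨h₁, h₂⟩ := arg_mem_Ioo_of_im_pos
        ((mul_pos h hτ).trans_eq (jfac_im γ τ).symm)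
      obtain ⟨h₃, h₄⟩ := arg_mem_Ioo_of_im_neg
        ((jfac_im γ _).trans_lt (mul_neg_of_pos_of_neg h hz'))
      constructor <;> linarith
  rw [abs_lt] at hj
  have hk₁ : (k : ℝ) < 1 := by nlinarith [Real.pi_pos]
  have hk₂ : (-1 : ℝ) < k := by nlinarith [Real.pi_pos]
  have hk₀ : k = 0 := by
    have h₁ : k < 1 := by exact_mod_cast hk₁
    have h₂ : -1 < k := by exact_mod_cast hk₂
    omega
  rw [hk₀, Int.cast_zero, mul_zero] at hk
  exact sub_eq_zero.1 hk

end
end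

section
/- Let γ, δ ∈ SL₂(ℝ). Then there exists ω ∈ {−1, 0, 1} such that for every z ∈ ℍ one has −arg(j(γδ, z)) + arg(j(γ, δz)) + arg(j(δ, z)) = 2πω (in particular this quantity is independent of z ∈ ℍ), and moreover for every r ∈ ℝ and every z ∈ ℍ, j(γ, δz)^r · j(δ, z)^r = e^{2πirω} · j(γδ, z)^r. -/
open Complex Real

noncomputable section

theorem jfac_ne_zero_s7 (γ : Matrix.SpecialLinearGroup (Fin 2) ℝ) {z : ℂ} (hz : 0 < z.im) :
    jfac γ z ≠ 0 := by
  simpa [UpperHalfPlane.denom, jfac] using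
    UpperHalfPlane.denom_ne_zero_of_im (γ : GL (Fin 2) ℝ) hz.ne'

theorem moeb_im_pos (γ : Matrix.SpecialLinearGroup (Fin 2) ℝ) {z : ℂ} (hz : 0 < z.im) :
    0 < (moeb γ z).im := by
  have hdet : γ.1 0 0 * γ.1 1 1 - γ.1 0 1 * γ.1 1 0 = 1 := by
    rw [← Matrix.det_fin_two]; exact γ.2
  have hN : 0 < Complex.normSq (jfac γ z) := Complex.normSq_pos.2 (jfac_ne_zero_s7 γ hz)
  have h : (moeb γ z).im = z.im / Complex.normSq (jfac γ z) := by
    rw [moeb, Complex.div_im, ← sub_div]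
    congr 1
    simp only [jfac, Complex.add_im, Complex.mul_im, Complex.add_re, Complex.mul_re,
      Complex.ofReal_re, Complex.ofReal_im]
    linear_combination z.im * hdet
  rw [h]
  exact div_pos hz hN

theorem jfac_mul (γ δ : Matrix.SpecialLinearGroup (Fin 2) ℝ) {z : ℂ} (hz : 0 < z.im) :
    jfac (γ * δ) z = jfac γ (moeb δ z) * jfac δ z := by
  have h := jfac_ne_zero_s7 δ hz
  rw [jfac.eq_1 γ, add_mul, mul_assoc, moeb, div_mul_cancel₀ _ h]
  simp only [jfac, Matrix.SpecialLinearGroup.coe_mul, Matrix.mul_apply, Fin.sum_univ_two]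
  push_cast
  ring

theorem continuous_jfac (γ : Matrix.SpecialLinearGroup (Fin 2) ℝ) : Continuous (jfac γ) := by
  unfold jfac
  fun_prop

theorem continuousOn_moeb (γ : Matrix.SpecialLinearGroup (Fin 2) ℝ) :
    ContinuousOn (moeb γ) {z | 0 < z.im} := by
  unfold moeb
  exact ContinuousOn.div (by fun_prop) (continuous_jfac γ).continuousOn
    fun z hz => jfac_ne_zero_s7 γ hz

theorem continuousOn_arg_jfac (γ : Matrix.SpecialLinearGroup (Fin 2) ℝ) :
    ContinuousOn (fun z => Complex.arg (jfac γ z)) {z | 0 < z.im} := by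
  by_cases hc : γ.1 1 0 = 0
  · simp only [jfac, hc, Complex.ofReal_zero, zero_mul, zero_add]
    exact continuousOn_const
  · refine fun z hz => ContinuousAt.continuousWithinAt ?_
    refine (Complex.continuousAt_arg (Or.inr ?_)).comp (continuous_jfac γ).continuousAt
    simpa [jfac] using ⟨hc, (ne_of_gt hz : z.im ≠ 0)⟩

/-- The arguments of two nonzero complex numbers add up to the argument of the product, up to
`2πω` with `ω ∈ {-1, 0, 1}`. -/
theorem exists_arg_add_arg_eq {x y : ℂ} (hx : x ≠ 0) (hy : y ≠ 0) :
    ∃ ω : ℤ, (ω = -1 ∨ ω = 0 ∨ ω = 1) ∧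
      -Complex.arg (x * y) + Complex.arg x + Complex.arg y = 2 * Real.pi * (ω : ℝ) := by
  obtain ⟨k, hk⟩ := Real.Angle.angle_eq_iff_two_pi_dvd_sub.1
    ((Real.Angle.coe_add _ _).trans (Complex.arg_mul_coe_angle hx hy).symm)
  have hπ := Real.pi_pos
  have h1 := Complex.neg_pi_lt_arg x
  have h2 := Complex.neg_pi_lt_arg y
  have h3 := Complex.neg_pi_lt_arg (x * y)
  have h4 := Complex.arg_le_pi x
  have h5 := Complex.arg_le_pi y
  have h6 := Complex.arg_le_pi (x * y)
  have hlt : (k : ℝ) < 2 := by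
    by_contra! h
    nlinarith
  have hgt : (-2 : ℝ) < k := by
    by_contra! h
    nlinarith
  have hlt' : k < 2 := by exact_mod_cast hlt
  have hgt' : -2 < k := by exact_mod_cast hgt
  exact ⟨k, by lia, by linarith⟩

theorem cpow_mul_cpow_of_arg_add_arg_eq {x y : ℂ} (hx : x ≠ 0) (hy : y ≠ 0) {ω : ℤ}
    (h : -Complex.arg (x * y) + Complex.arg x + Complex.arg y = 2 * Real.pi * (ω : ℝ)) (r : ℂ) :
    x ^ r * y ^ r = Complex.exp (2 * Real.pi * Complex.I * r * (ω : ℂ)) * (x * y) ^ r := by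
  have hlog : Real.log ‖x * y‖ = Real.log ‖x‖ + Real.log ‖y‖ := by
    rw [norm_mul, Real.log_mul (norm_ne_zero_iff.2 hx) (norm_ne_zero_iff.2 hy)]
  rw [Complex.cpow_def_of_ne_zero hx, Complex.cpow_def_of_ne_zero hy,
    Complex.cpow_def_of_ne_zero (mul_ne_zero hx hy), ← Complex.exp_add, ← Complex.exp_add]
  congr 1
  have h' := congrArg (fun t : ℝ => (t : ℂ)) h
  simp only [Complex.log, hlog]
  push_cast at h' ⊢
  linear_combination Complex.I * r * h'

/-- For `γ, δ ∈ SL₂(ℝ)` there is `ω ∈ {-1, 0, 1}` with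
`-arg j(γδ, z) + arg j(γ, δz) + arg j(δ, z) = 2πω` for every `z ∈ ℍ`
(in particular this quantity is independent of `z`), and moreover
`j(γ, δz)^r * j(δ, z)^r = e^{2πirω} * j(γδ, z)^r` for all `r ∈ ℝ`, `z ∈ ℍ`. -/
theorem petersson_omega_sigma (γ δ : Matrix.SpecialLinearGroup (Fin 2) ℝ) :
    ∃ ω : ℤ, (ω = -1 ∨ ω = 0 ∨ ω = 1) ∧
      (∀ z : ℂ, 0 < z.im →
        -Complex.arg (jfac (γ * δ) z) + Complex.arg (jfac γ (moeb δ z))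
          + Complex.arg (jfac δ z) = 2 * Real.pi * (ω : ℝ)) ∧
      ∀ r : ℝ, ∀ z : ℂ, 0 < z.im →
        jfac γ (moeb δ z) ^ (r : ℂ) * jfac δ z ^ (r : ℂ) =
          Complex.exp (2 * Real.pi * Complex.I * (r : ℂ) * (ω : ℂ)) *
            jfac (γ * δ) z ^ (r : ℂ) := by
  set f : ℂ → ℝ := fun z => -Complex.arg (jfac (γ * δ) z) + Complex.arg (jfac γ (moeb δ z))
    + Complex.arg (jfac δ z)
  have hf : ∀ z : ℂ, 0 < z.im →
      ∃ ω : ℤ, (ω = -1 ∨ ω = 0 ∨ ω = 1) ∧ f z = 2 * Real.pi * (ω : ℝ) := fun z hz => by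
    simp only [f, jfac_mul γ δ hz]
    exact exists_arg_add_arg_eq (jfac_ne_zero_s7 γ (moeb_im_pos δ hz)) (jfac_ne_zero_s7 δ hz)
  have hcont : ContinuousOn f {z | 0 < z.im} :=
    ((continuousOn_arg_jfac (γ * δ)).neg.add ((continuousOn_arg_jfac γ).comp
      (continuousOn_moeb δ) fun z hz => moeb_im_pos δ hz)).add (continuousOn_arg_jfac δ)
  have hmaps : Set.MapsTo f {z | 0 < z.im} {2 * Real.pi * (-1), 0, 2 * Real.pi} := fun z hz => by
    obtain ⟨ω, rfl | rfl | rfl, h⟩ := hf z hz <;> simp [h]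
  have hconst {z w : ℂ} (hz : 0 < z.im) (hw : 0 < w.im) : f z = f w :=
    (convex_halfSpace_im_gt 0).isPreconnected.constant_of_mapsTo (Set.toFinite _).isDiscrete hcont hmaps hz hw
  have hI : 0 < Complex.I.im := by simp
  obtain ⟨ω, hω, hfI⟩ := hf Complex.I hI
  have harg (z : ℂ) (hz : 0 < z.im) : f z = 2 * Real.pi * (ω : ℝ) := (hconst hz hI).trans hfI
  refine ⟨ω, hω, harg, fun r z hz => ?_⟩
  have h := harg z hz
  simp only [f, jfac_mul γ δ hz] at h
  rw [jfac_mul γ δ hz]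
  exact cpow_mul_cpow_of_arg_add_arg_eq (jfac_ne_zero_s7 γ (moeb_im_pos δ hz))
    (jfac_ne_zero_s7 δ hz) h r

end
end

section
/- Let Γ be a discrete subgroup of SL₂(ℝ) containing the translation matrix (1 λ; 0 1) for some λ > 0. Then there exists c₀ > 0 such that every γ = (a b; c d) ∈ Γ with c ≠ 0 satisfies |c| ≥ c₀. -/
open Complex

noncomputable section

/-- The iterated conjugates `γ, γ T γ⁻¹, …` of Shimizu's argument. -/
def shimizuSeq {G : Type*} [Group G] (T γ : G) : ℕ → G
  | 0 => γ
  | n + 1 => shimizuSeq T γ n * T * (shimizuSeq T γ n)⁻¹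

theorem shimizuSeq_mem {G : Type*} [Group G] {Γ : Subgroup G} {T γ : G}
    (hT : T ∈ Γ) (hγ : γ ∈ Γ) (n : ℕ) : shimizuSeq T γ n ∈ Γ := by
  induction n with
  | zero => exact hγ
  | succ n ih => exact Γ.mul_mem (Γ.mul_mem ih hT) (Γ.inv_mem ih)

theorem coe_conj_translation {T : Matrix.SpecialLinearGroup (Fin 2) ℝ} {lam : ℝ}
    (hT : T.1 = !![1, lam; 0, 1]) (g : Matrix.SpecialLinearGroup (Fin 2) ℝ) :
    (g * T * g⁻¹).1 = !![1 - lam * (g.1 0 0 * g.1 1 0), lam * g.1 0 0 ^ 2;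
      -(lam * g.1 1 0 ^ 2), 1 + lam * (g.1 0 0 * g.1 1 0)] := by
  have hdet := g.2
  rw [Matrix.det_fin_two] at hdet
  change g.1 * T.1 * (g⁻¹).1 = _
  rw [hT, Matrix.SpecialLinearGroup.coe_inv, Matrix.adjugate_fin_two]
  ext i j
  fin_cases i <;> fin_cases j <;> simp [Matrix.mul_apply, Fin.sum_univ_two]
  · linear_combination hdet
  · ring
  · ring
  · linear_combination hdet

section Convergence

variable {T : Matrix.SpecialLinearGroup (Fin 2) ℝ} {lam : ℝ}

theorem shimizuSeq_lower_left_ne_zero (hlam : 0 < lam) (hT : T.1 = !![1, lam; 0, 1])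
    {γ : Matrix.SpecialLinearGroup (Fin 2) ℝ} (hγ : γ.1 1 0 ≠ 0) (n : ℕ) :
    (shimizuSeq T γ n).1 1 0 ≠ 0 := by
  induction n with
  | zero => exact hγ
  | succ n ih =>
    rw [shimizuSeq, coe_conj_translation hT]
    simpa using ⟨hlam.ne', ih⟩

theorem abs_lower_left_shimizuSeq_le (hlam : 0 < lam) (hT : T.1 = !![1, lam; 0, 1])
    {γ : Matrix.SpecialLinearGroup (Fin 2) ℝ} (hγ : lam * |γ.1 1 0| < 1) (n : ℕ) :
    lam * |(shimizuSeq T γ n).1 1 0| ≤ (lam * |γ.1 1 0|) ^ (n + 1) := by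
  have h0 : 0 ≤ lam * |γ.1 1 0| := by positivity
  induction n with
  | zero => simp [shimizuSeq]
  | succ n ih =>
    rw [shimizuSeq, coe_conj_translation hT]
    calc lam * |-(lam * (shimizuSeq T γ n).1 1 0 ^ 2)|
        = (lam * |(shimizuSeq T γ n).1 1 0|) ^ 2 := by
          rw [abs_neg, abs_mul, abs_pow, abs_of_pos hlam]; ring
      _ ≤ ((lam * |γ.1 1 0|) ^ (n + 1)) ^ 2 := by gcongr
      _ ≤ (lam * |γ.1 1 0|) ^ (n + 1 + 1) := by
          rw [← pow_mul]
          exact pow_le_pow_of_le_one h0 hγ.le (by omega)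

theorem exists_abs_upper_left_shimizuSeq_le (hlam : 0 < lam) (hT : T.1 = !![1, lam; 0, 1])
    {γ : Matrix.SpecialLinearGroup (Fin 2) ℝ} (hγ : lam * |γ.1 1 0| < 1) :
    ∃ M : ℝ, ∀ n, |(shimizuSeq T γ n).1 0 0| ≤ M := by
  set t := lam * |γ.1 1 0| with ht
  have h0 : 0 ≤ t := by positivity
  refine ⟨max |γ.1 0 0| (1 / (1 - t)), fun n => ?_⟩
  induction n with
  | zero => exact le_max_left _ _
  | succ n ih =>
    set M := max |γ.1 0 0| (1 / (1 - t))
    have hM : 1 ≤ M * (1 - t) := (div_le_iff₀ (by linarith)).1 (le_max_right _ _)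
    have hc : lam * |(shimizuSeq T γ n).1 1 0| ≤ t :=
      (abs_lower_left_shimizuSeq_le hlam hT hγ n).trans
        (pow_le_of_le_one h0 hγ.le n.succ_ne_zero)
    rw [shimizuSeq, coe_conj_translation hT]
    calc |1 - lam * ((shimizuSeq T γ n).1 0 0 * (shimizuSeq T γ n).1 1 0)|
        ≤ |1| + |lam * ((shimizuSeq T γ n).1 0 0 * (shimizuSeq T γ n).1 1 0)| := abs_sub _ _
      _ = 1 + |(shimizuSeq T γ n).1 0 0| * (lam * |(shimizuSeq T γ n).1 1 0|) := by
          rw [abs_one, abs_mul, abs_mul, abs_of_pos hlam]; ring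
      _ ≤ 1 + M * t := by gcongr
      _ ≤ M := by linarith

theorem tendsto_shimizuSeq (hlam : 0 < lam) (hT : T.1 = !![1, lam; 0, 1])
    {γ : Matrix.SpecialLinearGroup (Fin 2) ℝ} (hγ : lam * |γ.1 1 0| < 1) :
    Filter.Tendsto (fun n => (shimizuSeq T γ n).1) Filter.atTop (nhds T.1) := by
  have h0 : 0 ≤ lam * |γ.1 1 0| := by positivity
  obtain ⟨M, hM⟩ := exists_abs_upper_left_shimizuSeq_le hlam hT hγ
  have hc : Filter.Tendsto (fun n => (shimizuSeq T γ n).1 1 0) Filter.atTop (nhds 0) := by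
    have hpow := ((tendsto_pow_atTop_nhds_zero_of_lt_one h0 hγ).comp
      (Filter.tendsto_add_atTop_nat 1)).div_const lam
    rw [zero_div] at hpow
    refine squeeze_zero_norm (fun n => ?_) hpow
    rw [Real.norm_eq_abs, le_div_iff₀' hlam]
    exact abs_lower_left_shimizuSeq_le hlam hT hγ n
  have hac : Filter.Tendsto
      (fun n => (shimizuSeq T γ n).1 0 0 * (shimizuSeq T γ n).1 1 0) Filter.atTop (nhds 0) := by
    have hb := hc.abs.const_mul M
    rw [abs_zero, mul_zero] at hb
    refine squeeze_zero_norm (fun n => ?_) hb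
    rw [Real.norm_eq_abs, abs_mul]
    gcongr
    exact hM n
  have ha : Filter.Tendsto (fun n => (shimizuSeq T γ n).1 0 0) Filter.atTop (nhds 1) := by
    rw [← Filter.tendsto_add_atTop_iff_nat 1]
    simpa [shimizuSeq, coe_conj_translation hT] using (hac.const_mul lam).const_sub 1
  rw [← Filter.tendsto_add_atTop_iff_nat 1]
  simp only [shimizuSeq, coe_conj_translation hT, hT]
  refine tendsto_pi_nhds.2 fun i => tendsto_pi_nhds.2 fun j => ?_
  fin_cases i <;> fin_cases j
  · simpa using (hac.const_mul lam).const_sub 1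
  · simpa using (ha.pow 2).const_mul lam
  · simpa using ((hc.pow 2).const_mul lam).neg
  · simpa using (hac.const_mul lam).const_add 1

end Convergence

/-- Let `Γ` be a subgroup of `SL₂(ℝ)` that is discrete (as a subset of the
`2 × 2` real matrices, which induces the topology of `SL₂(ℝ)`), containing the
translation matrix `(1 λ; 0 1)` for some `λ > 0`. Then there is `c₀ > 0` such
that every `γ = (a b; c d) ∈ Γ` with `c ≠ 0` satisfies `|c| ≥ c₀`. -/
theorem discrete_group_lower_left_bound
    (Γ : Subgroup (Matrix.SpecialLinearGroup (Fin 2) ℝ))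
    (hdisc : DiscreteTopology
      {A : Matrix (Fin 2) (Fin 2) ℝ // ∃ γ ∈ Γ,
        (γ : Matrix.SpecialLinearGroup (Fin 2) ℝ).1 = A})
    (lam : ℝ) (hlam : 0 < lam)
    (hT : ∃ γ ∈ Γ, (γ : Matrix.SpecialLinearGroup (Fin 2) ℝ).1 =
      !![(1 : ℝ), lam; 0, 1]) :
    ∃ c₀ : ℝ, 0 < c₀ ∧ ∀ γ ∈ Γ,
      (γ : Matrix.SpecialLinearGroup (Fin 2) ℝ).1 1 0 ≠ 0 →
        c₀ ≤ |(γ : Matrix.SpecialLinearGroup (Fin 2) ℝ).1 1 0| := by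
  obtain ⟨T, hTΓ, hT⟩ := hT
  refine ⟨1 / lam, by positivity, fun γ hγ hc => ?_⟩
  by_contra! hlt
  rw [lt_div_iff₀' hlam] at hlt
  let S := {A : Matrix (Fin 2) (Fin 2) ℝ // ∃ γ ∈ Γ,
    (γ : Matrix.SpecialLinearGroup (Fin 2) ℝ).1 = A}
  let u : ℕ → S := fun n => ⟨_, _, shimizuSeq_mem hTΓ hγ n, rfl⟩
  have hu : Filter.Tendsto u Filter.atTop (nhds (⟨T.1, T, hTΓ, rfl⟩ : S)) :=
    tendsto_subtype_rng.2 (tendsto_shimizuSeq hlam hT hlt)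
  rw [nhds_discrete, Filter.tendsto_pure] at hu
  obtain ⟨n, hn⟩ := hu.exists
  apply shimizuSeq_lower_left_ne_zero hlam hT hc n
  have heq : (shimizuSeq T γ n).1 = T.1 := Subtype.mk.inj hn
  rw [heq, hT]
  simp

end
end
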